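/- Let A be a complete NBW over Σ that is limit deterministic with partition (Q_N, Q_D), fix a linear order ≼ on Q in which every element of Q_D precedes every element of Q_N, let w be an ω-word, and let Ĝ be the LDBW run DAG of A over w. Let ρ be a run of A on w whose representative M(ρ) in Ĝ is a finite branch. Then there exists a run ρ* of A on w such that M(ρ*) is an ω-branch of Ĝ and ρ merges with ρ*, i.e., there exists n ∈ ℕ with ρ(i) = ρ*(i) for all i ≥ n. -/

import Mathlib

open scoped Classical

/-- A nondeterministic Büchi automaton on ω-words with states `Q` over alphabet `σ`. -/
structure NBW (σ : Type) (Q : Type) where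
  init : Set Q
  trans : Q → σ → Set Q
  acc : Set Q

namespace NBW

variable {σ Q : Type}

/-- `ρ` is a run of `A` on the ω-word `w`. -/
def IsRun (A : NBW σ Q) (w : ℕ → σ) (ρ : ℕ → Q) : Prop :=
  ρ 0 ∈ A.init ∧ ∀ i, ρ (i + 1) ∈ A.trans (ρ i) (w i)

/-- `ρ` is an accepting run of `A` on `w`: it visits `A.acc` infinitely often. -/
def IsAccRun (A : NBW σ Q) (w : ℕ → σ) (ρ : ℕ → Q) : Prop :=
  A.IsRun w ρ ∧ ∀ n, ∃ m, n ≤ m ∧ ρ m ∈ A.acc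

/-- The ω-language accepted by `A`. -/
def Lang (A : NBW σ Q) : Set (ℕ → σ) := {w | ∃ ρ, A.IsAccRun w ρ}

/-- `A` is complete: every state has a successor on every letter. -/
def Complete (A : NBW σ Q) : Prop := ∀ q a, (A.trans q a).Nonempty

/-- `A` is finitely ambiguous: every accepted word has finitely many accepting runs. -/
def FinitelyAmbiguous (A : NBW σ Q) : Prop :=
  ∀ w ∈ A.Lang, {ρ | A.IsAccRun w ρ}.Finite

/-- `A` is limit deterministic with partition `(QN, QD)`. -/
def LimitDetPart (A : NBW σ Q) (QN QD : Set Q) : Prop :=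
  Disjoint QN QD ∧ QN ∪ QD = Set.univ ∧ A.acc ⊆ QD ∧
    ∀ q ∈ QD, ∀ a, ∃ q' ∈ QD, A.trans q a = {q'}

/-- `A` is limit deterministic (for some partition). -/
def LimitDet (A : NBW σ Q) : Prop := ∃ QN QD, A.LimitDetPart QN QD

end NBW

namespace NBW

variable {σ Q : Type}

/-- `S_ℓ`: the nondeterministic states reached at level `ℓ`. -/
def ldS (A : NBW σ Q) (QN : Set Q) (w : ℕ → σ) : ℕ → Set Q
  | 0 => A.init ∩ QN
  | ℓ + 1 => (⋃ q ∈ ldS A QN w ℓ, A.trans q (w ℓ)) ∩ QN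

/-- `P_ℓ`: the deterministic states present at level `ℓ`. -/
def ldP (A : NBW σ Q) (QN QD : Set Q) (dD : Q → σ → Q) (w : ℕ → σ) : ℕ → Set Q
  | 0 => A.init ∩ QD
  | ℓ + 1 =>
    ((fun q => dD q (w ℓ)) '' ldP A QN QD dD w ℓ) ∪
      (((⋃ q ∈ ldS A QN w ℓ, A.trans q (w ℓ)) ∩ QD) \
        ((fun q => dD q (w ℓ)) '' ldP A QN QD dD w ℓ))

/-- `D_{ℓ+1}`: the `δ_D`-successors of `P_ℓ`. -/
def ldD (A : NBW σ Q) (QN QD : Set Q) (dD : Q → σ → Q) (w : ℕ → σ) (ℓ : ℕ) : Set Q :=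
  (fun q => dD q (w ℓ)) '' ldP A QN QD dD w ℓ

/-- `J_{ℓ+1}`: the deterministic states freshly reached by a jump from `S_ℓ`. -/
def ldJ (A : NBW σ Q) (QN QD : Set Q) (dD : Q → σ → Q) (w : ℕ → σ) (ℓ : ℕ) : Set Q :=
  ((⋃ q ∈ ldS A QN w ℓ, A.trans q (w ℓ)) ∩ QD) \ ldD A QN QD dD w ℓ

/-- Priorities at level `ℓ`: the first component gives the priority of a
deterministic vertex `⟨q, ℓ⟩` and the second component the priority of the
nondeterministic vertex `⟨S_ℓ, ℓ⟩`. -/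
noncomputable def ldPr (A : NBW σ Q) [LinearOrder Q] (QN QD : Set Q) (dD : Q → σ → Q)
    (w : ℕ → σ) : ℕ → (Q → ℕ) × ℕ
  | 0 =>
    (fun q => {q' ∈ A.init ∩ QD | q' ≤ q}.ncard, (A.init ∩ QD).ncard + 1)
  | ℓ + 1 =>
    (fun q =>
      if q ∈ ldD A QN QD dD w ℓ then
        sInf ((ldPr A QN QD dD w ℓ).1 '' {q' ∈ ldP A QN QD dD w ℓ | dD q' (w ℓ) = q})
      else (ldPr A QN QD dD w ℓ).2 + {j ∈ ldJ A QN QD dD w ℓ | j ≤ q}.ncard - 1,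
     (ldPr A QN QD dD w ℓ).2 + (ldJ A QN QD dD w ℓ).ncard)

/-- The vertices of the LDBW run DAG `Ĝ` at level `ℓ`: `some q` is the deterministic
vertex `⟨q, ℓ⟩`, `none` is the nondeterministic vertex `⟨S_ℓ, ℓ⟩`. -/
def ldVtx (A : NBW σ Q) (QN QD : Set Q) (dD : Q → σ → Q) (w : ℕ → σ)
    (v : Option Q) (ℓ : ℕ) : Prop :=
  match v with
  | some q => q ∈ ldP A QN QD dD w ℓ
  | none => (ldS A QN w ℓ).Nonempty

/-- The edges of the LDBW run DAG `Ĝ`, from a vertex at level `ℓ` to one at level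
`ℓ+1`. -/
def ldEdge (A : NBW σ Q) [LinearOrder Q] (QN QD : Set Q) (dD : Q → σ → Q)
    (w : ℕ → σ) (u : Option Q) (ℓ : ℕ) (v : Option Q) : Prop :=
  match u, v with
  | none, none => (ldS A QN w ℓ).Nonempty ∧ (ldS A QN w (ℓ + 1)).Nonempty
  | none, some j => (ldS A QN w ℓ).Nonempty ∧ j ∈ ldJ A QN QD dD w ℓ
  | some q, some d =>
      q ∈ ldP A QN QD dD w ℓ ∧ d = dD q (w ℓ) ∧
        (ldPr A QN QD dD w (ℓ + 1)).1 d = (ldPr A QN QD dD w ℓ).1 q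
  | some _, none => False

/-- `γ` is an initial ω-branch of `Ĝ` (an ω-branch starting at level `0`). -/
def ldInitOmegaBranch (A : NBW σ Q) [LinearOrder Q] (QN QD : Set Q)
    (dD : Q → σ → Q) (w : ℕ → σ) (γ : ℕ → Option Q) : Prop :=
  (∀ ℓ, ldVtx A QN QD dD w (γ ℓ) ℓ) ∧
    ∀ ℓ, ldEdge A QN QD dD w (γ ℓ) ℓ (γ (ℓ + 1))

/-- The branch `γ` of `Ĝ` is accepting: it contains infinitely many `F`-vertices. -/
def ldAcceptingBranch (A : NBW σ Q) (γ : ℕ → Option Q) : Prop :=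
  ∀ n, ∃ m, n ≤ m ∧ ∃ q, γ m = some q ∧ q ∈ A.acc

/-- There is an ω-branch of `Ĝ` starting at the vertex `v` of level `ℓ`. -/
def ldOmegaBranchFrom (A : NBW σ Q) [LinearOrder Q] (QN QD : Set Q)
    (dD : Q → σ → Q) (w : ℕ → σ) (v : Option Q) (ℓ : ℕ) : Prop :=
  ∃ γ : ℕ → Option Q, γ 0 = v ∧ (∀ i, ldVtx A QN QD dD w (γ i) (ℓ + i)) ∧
    ∀ i, ldEdge A QN QD dD w (γ i) (ℓ + i) (γ (i + 1))

end NBW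

namespace NBW

variable {σ Q : Type}

/-- The candidate sequence of vertices of the representative `M(ρ)` of a run `ρ`
whose first deterministic state occurs at position `j`. -/
def MCand (ρ : ℕ → Q) (j i : ℕ) : Option Q :=
  if i < j then none else some (ρ i)

/-- The representative `M(ρ)` of the run `ρ` in `Ĝ` is an ω-branch. -/
def MIsOmega (A : NBW σ Q) [LinearOrder Q] (QN QD : Set Q) (dD : Q → σ → Q)
    (w : ℕ → σ) (ρ : ℕ → Q) : Prop :=
  (∀ i, ρ i ∈ QN) ∨
    ∃ j, (∀ i, i < j → ρ i ∈ QN) ∧ ρ j ∈ QD ∧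
      ∀ k, ldEdge A QN QD dD w (MCand ρ j k) k (MCand ρ j (k + 1))

/-- The representative `M(ρ)` of the run `ρ` in `Ĝ` is a finite branch: the
candidate sequence of vertices has a missing edge. -/
def MIsFinite (A : NBW σ Q) [LinearOrder Q] (QN QD : Set Q) (dD : Q → σ → Q)
    (w : ℕ → σ) (ρ : ℕ → Q) : Prop :=
  ∃ j, (∀ i, i < j → ρ i ∈ QN) ∧ ρ j ∈ QD ∧
    ∃ k, ¬ ldEdge A QN QD dD w (MCand ρ j k) k (MCand ρ j (k + 1))

end NBW

namespace NBW

variable {σ Q : Type}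

lemma ldS_pre (A : NBW σ Q) (QN : Set Q) (w : ℕ → σ) : ∀ (ℓ : ℕ) (ρ : ℕ → Q),
    ρ ℓ ∈ ldS A QN w ℓ → ∃ r : ℕ → Q, (∀ i, ℓ ≤ i → r i = ρ i) ∧ r 0 ∈ A.init ∧
      (∀ i, i < ℓ → r (i + 1) ∈ A.trans (r i) (w i)) ∧
      (∀ i, i ≤ ℓ → r i ∈ QN ∧ r i ∈ ldS A QN w i) := by
  intro ℓ
  induction ℓ with
  | zero =>
    intro ρ h
    refine ⟨ρ, fun _ _ => rfl, h.1, by simp, ?_⟩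
    intro i hi
    obtain rfl : i = 0 := by omega
    exact ⟨h.2, h⟩
  | succ ℓ ih =>
    intro ρ h
    have h' := h
    simp only [ldS, Set.mem_inter_iff, Set.mem_iUnion] at h'
    obtain ⟨⟨q, hq, hqt⟩, hN⟩ := h'
    obtain ⟨r, h1, h2, h3, h4⟩ := ih (Function.update ρ ℓ q) (by simpa using hq)
    have hl : r ℓ = q := by simpa using h1 ℓ le_rfl
    have hg : ∀ i, ℓ + 1 ≤ i → r i = ρ i := fun i hi => by
      rw [h1 i (by omega), Function.update_of_ne (by omega)]
    refine ⟨r, hg, h2, ?_, ?_⟩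
    · intro i hi
      rcases Nat.lt_succ_iff_lt_or_eq.1 hi with hi | rfl
      · exact h3 i hi
      · rw [hl, hg _ le_rfl]; exact hqt
    · intro i hi
      rcases Nat.lt_or_eq_of_le hi with hi | rfl
      · exact h4 i (by omega)
      · rw [hg _ le_rfl]; exact ⟨hN, h⟩

lemma ldP_sub (A : NBW σ Q) (QN QD : Set Q) (dD : Q → σ → Q)
    (hQD : ∀ q ∈ QD, ∀ a, dD q a ∈ QD) (w : ℕ → σ) (ℓ : ℕ) :
    ldP A QN QD dD w ℓ ⊆ QD := by
  induction ℓ with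
  | zero => exact fun q h => h.2
  | succ ℓ ih =>
    rintro q (⟨q', h, rfl⟩ | h)
    · exact hQD _ (ih h) _
    · exact h.1.2

lemma ldP_pre (A : NBW σ Q) [LinearOrder Q] (QN QD : Set Q) (dD : Q → σ → Q)
    (hQD : ∀ q ∈ QD, ∀ a, dD q a ∈ QD)
    (hdD : ∀ q ∈ QD, ∀ a, A.trans q a = {dD q a}) (w : ℕ → σ) :
    ∀ (ℓ : ℕ) (ρ : ℕ → Q),
    ρ ℓ ∈ ldP A QN QD dD w ℓ → ∃ (r : ℕ → Q) (j : ℕ), j ≤ ℓ ∧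
      (∀ i, ℓ ≤ i → r i = ρ i) ∧ r 0 ∈ A.init ∧
      (∀ i, i < ℓ → r (i + 1) ∈ A.trans (r i) (w i)) ∧
      (∀ i, i < j → r i ∈ QN) ∧ r j ∈ QD ∧
      (∀ k, k < ℓ → ldEdge A QN QD dD w (MCand r j k) k (MCand r j (k + 1))) := by
  intro ℓ
  induction ℓ with
  | zero =>
    intro ρ h
    exact ⟨ρ, 0, le_rfl, fun _ _ => rfl, h.1, by simp, by simp, h.2, by simp⟩
  | succ ℓ ih =>
    intro ρ h
    by_cases hD : ρ (ℓ + 1) ∈ ldD A QN QD dD w ℓ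
    · have hne : ((ldPr A QN QD dD w ℓ).1 ''
          {q' ∈ ldP A QN QD dD w ℓ | dD q' (w ℓ) = ρ (ℓ + 1)}).Nonempty := by
        obtain ⟨q, hq, he⟩ := hD
        exact ⟨_, q, ⟨hq, he⟩, rfl⟩
      obtain ⟨q, ⟨hq, he⟩, hp⟩ := Nat.sInf_mem hne
      obtain ⟨r, j, hj, h1, h2, h3, h4, h5, h6⟩ :=
        ih (Function.update ρ ℓ q) (by simpa using hq)
      have hl : r ℓ = q := by simpa using h1 ℓ le_rfl
      have hg : ∀ i, ℓ + 1 ≤ i → r i = ρ i := fun i hi => by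
        rw [h1 i (by omega), Function.update_of_ne (by omega)]
      refine ⟨r, j, by omega, hg, h2, ?_, h4, h5, ?_⟩
      · intro i hi
        rcases Nat.lt_succ_iff_lt_or_eq.1 hi with hi | rfl
        · exact h3 i hi
        · rw [hl, hg _ le_rfl, hdD q (ldP_sub A QN QD dD hQD w _ hq)]
          exact he.symm
      · intro k hk
        rcases Nat.lt_succ_iff_lt_or_eq.1 hk with hk | rfl
        · exact h6 k hk
        · rw [MCand, MCand, if_neg (by omega), if_neg (by omega), hl, hg _ le_rfl]
          refine ⟨hq, he.symm, ?_⟩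
          rw [hp]
          simp only [ldPr, if_pos hD]
    · have hJ : ρ (ℓ + 1) ∈ ldJ A QN QD dD w ℓ := by
        rcases h with h | h
        · exact absurd h hD
        · exact h
      have h' := hJ.1
      simp only [Set.mem_inter_iff, Set.mem_iUnion] at h'
      obtain ⟨⟨q, hq, hqt⟩, hN⟩ := h'
      obtain ⟨r, h1, h2, h3, h4⟩ :=
        ldS_pre A QN w ℓ (Function.update ρ ℓ q) (by simpa using hq)
      have hl : r ℓ = q := by simpa using h1 ℓ le_rfl
      have hg : ∀ i, ℓ + 1 ≤ i → r i = ρ i := fun i hi => by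
        rw [h1 i (by omega), Function.update_of_ne (by omega)]
      refine ⟨r, ℓ + 1, le_rfl, hg, h2, ?_, fun i hi => (h4 i (by omega)).1, ?_, ?_⟩
      · intro i hi
        rcases Nat.lt_succ_iff_lt_or_eq.1 hi with hi | rfl
        · exact h3 i hi
        · rw [hl, hg _ le_rfl]; exact hqt
      · rw [hg _ le_rfl]; exact hN
      · intro k hk
        rcases Nat.lt_succ_iff_lt_or_eq.1 hk with hk | rfl
        · rw [MCand, MCand, if_pos (by omega), if_pos (by omega)]
          exact ⟨⟨_, (h4 k (by omega)).2⟩, ⟨_, (h4 (k + 1) (by omega)).2⟩⟩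
        · rw [MCand, MCand, if_pos (by omega), if_neg (by omega), hg _ le_rfl]
          exact ⟨⟨_, hq⟩, hJ⟩

end NBW

/-- Every run whose representative in `Ĝ` is a finite branch merges with a run
whose representative is an ω-branch of `Ĝ`. -/
theorem NBW.ldbw_merge_with_omega_branch (σ Q : Type) [Fintype σ] [Nonempty σ]
    [Fintype Q] [LinearOrder Q] (A : NBW σ Q) (QN QD : Set Q) (dD : Q → σ → Q)
    (hc : A.Complete) (hld : A.LimitDetPart QN QD)
    (hdD : ∀ q ∈ QD, ∀ a, A.trans q a = {dD q a})
    (hord : ∀ d ∈ QD, ∀ q ∈ QN, d ≤ q)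
    (w : ℕ → σ) (ρ : ℕ → Q) (hρ : A.IsRun w ρ)
    (hfin : A.MIsFinite QN QD dD w ρ) :
    ∃ ρstar : ℕ → Q, A.IsRun w ρstar ∧ A.MIsOmega QN QD dD w ρstar ∧
      ∃ n : ℕ, ∀ i, n ≤ i → ρ i = ρstar i := by
  have hQD : ∀ q ∈ QD, ∀ a, dD q a ∈ QD := by
    intro q hq a
    obtain ⟨q', h, he⟩ := hld.2.2.2 q hq a
    rw [hdD q hq a] at he
    rw [Set.singleton_injective he]; exact h
  obtain ⟨j, hjN, hjD, -⟩ := hfin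
  have hS : ∀ i, i < j → ρ i ∈ NBW.ldS A QN w i := by
    intro i
    induction i with
    | zero => exact fun h => ⟨hρ.1, hjN 0 h⟩
    | succ i ih =>
      intro h
      refine ⟨?_, hjN _ h⟩
      simp only [Set.mem_iUnion]
      exact ⟨ρ i, ih (by omega), hρ.2 i⟩
  have hPj : ρ j ∈ NBW.ldP A QN QD dD w j := by
    cases j with
    | zero => exact ⟨hρ.1, hjD⟩
    | succ i =>
      by_cases hD : ρ (i + 1) ∈ NBW.ldD A QN QD dD w i
      · exact Or.inl hD
      · refine Or.inr ⟨⟨?_, hjD⟩, hD⟩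
        simp only [Set.mem_iUnion]
        exact ⟨ρ i, hS i (by omega), hρ.2 i⟩
  have hstep : ∀ i, ρ i ∈ NBW.ldP A QN QD dD w i → ρ (i + 1) = dD (ρ i) (w i) := by
    intro i hi
    have := hρ.2 i
    rw [hdD _ (NBW.ldP_sub A QN QD dD hQD w i hi)] at this
    exact this
  have hP : ∀ i, ρ (j + i) ∈ NBW.ldP A QN QD dD w (j + i) := by
    intro i
    induction i with
    | zero => exact hPj
    | succ i ih => exact Or.inl ⟨_, ih, (hstep _ ih).symm⟩
  have hanti : Antitone fun i => (NBW.ldPr A QN QD dD w (j + i)).1 (ρ (j + i)) := by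
    refine antitone_nat_of_succ_le fun i => ?_
    have hD : ρ (j + i + 1) ∈ NBW.ldD A QN QD dD w (j + i) :=
      ⟨_, hP i, (hstep _ (hP i)).symm⟩
    change (NBW.ldPr A QN QD dD w (j + i + 1)).1 (ρ (j + i + 1)) ≤ _
    simp only [NBW.ldPr, if_pos hD]
    exact Nat.sInf_le ⟨_, ⟨hP i, (hstep _ (hP i)).symm⟩, rfl⟩
  obtain ⟨n, hn⟩ := WellFoundedGT.monotone_chain_condition
    (α := ℕᵒᵈ) ⟨_, hanti.dual_right⟩
  obtain ⟨r, j', hj', h1, h2, h3, h4, h5, h6⟩ :=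
    NBW.ldP_pre A QN QD dD hQD hdD w (j + n) ρ (hP n)
  refine ⟨r, ⟨h2, fun i => ?_⟩, Or.inr ⟨j', h4, h5, fun k => ?_⟩, j + n,
    fun i hi => (h1 i hi).symm⟩
  · by_cases hi : i < j + n
    · exact h3 i hi
    · rw [h1 _ (by omega), h1 _ (by omega)]; exact hρ.2 i
  · by_cases hk : k < j + n
    · exact h6 k hk
    · obtain ⟨m, rfl⟩ : ∃ m, k = j + m := ⟨k - j, by omega⟩
      rw [NBW.MCand, NBW.MCand, if_neg (by omega), if_neg (by omega), h1 _ (by omega),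
        h1 _ (by omega)]
      refine ⟨hP m, hstep _ (hP m), ?_⟩
      have e1 := hn m (by omega)
      have e2 := hn (m + 1) (by omega)
      exact e2.symm.trans e1
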